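/- arXiv:1405.5276 — 4 statements merged into one kernel-verified Lean document; each statement's English description precedes it below -/
import Mathlib

section
/- Let F be a finite field with |F| = q, let k ≥ 1, let V be a 2k-dimensional F-vector space, and let m, k1, k2, t be integers with 0 ≤ k1 ≤ k2, k1 + k2 ≤ m ≤ k and 0 ≤ t ≤ m − 1. Let U1, U2 be m-dimensional subspaces of V with dim(U1 ∩ U2) = t. Then at least one of the following holds: (a) there exist k-dimensional subspaces V1, V2 of V with V1 ∩ V2 = 0 and V1 + V2 = V such that both U1 and U2 are (k1,k2)-incident with the bisection {V1, V2}; (b) q = 2, k1 = 0, t = 0 and k = m = k2 + 1; (c) k + 1 + m + k1 < 3·k2 and t + k2 > m + k1. -/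
open Module

/-- `{V₁, V₂}` is a bisection of `V` into two `k`-dimensional subspaces. -/
def IsBisection {F V : Type*} [Field F] [AddCommGroup V] [Module F V]
    (k : ℕ) (V₁ V₂ : Submodule F V) : Prop :=
  finrank F V₁ = k ∧ finrank F V₂ = k ∧ V₁ ⊓ V₂ = ⊥ ∧ V₁ ⊔ V₂ = ⊤

/-- The unordered pair of intersection dimensions of `U` with `V₁, V₂` is `(k₁, k₂)`. -/
def Incident {F V : Type*} [Field F] [AddCommGroup V] [Module F V]
    (k₁ k₂ : ℕ) (U V₁ V₂ : Submodule F V) : Prop :=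
  (finrank F ↥(U ⊓ V₁) = k₁ ∧ finrank F ↥(U ⊓ V₂) = k₂) ∨
  (finrank F ↥(U ⊓ V₁) = k₂ ∧ finrank F ↥(U ⊓ V₂) = k₁)

/-- There are subspaces `U₁, U₂` of relative position `(t, p₁, p₂, w)` in a finite-dimensional space
and a decomposition `V₁ ⊕ V₂` of that space into parts of dimensions `d₁, d₂` such that
`dim (Uᵢ ∩ Vⱼ) = aᵢⱼ`. Here `t = dim (U₁ ∩ U₂)`, `pᵢ = dim Uᵢ - t`, and `w` is the codimension
of `U₁ + U₂`. -/
def Realizable.{u} (F : Type u) [Field F]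
    (t p₁ p₂ w a₁₁ a₁₂ a₂₁ a₂₂ d₁ d₂ : ℕ) : Prop :=
  ∃ (V : Type u) (_ : AddCommGroup V) (_ : Module F V) (_ : FiniteDimensional F V)
    (U₁ U₂ V₁ V₂ : Submodule F V),
    (finrank F V = t + p₁ + p₂ + w ∧ finrank F V = d₁ + d₂) ∧
    (finrank F ↥(U₁ ⊓ U₂) = t ∧ finrank F U₁ = t + p₁ ∧ finrank F U₂ = t + p₂) ∧
    (finrank F ↥(U₁ ⊓ V₁) = a₁₁ ∧ finrank F ↥(U₁ ⊓ V₂) = a₁₂) ∧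
    (finrank F ↥(U₂ ⊓ V₁) = a₂₁ ∧ finrank F ↥(U₂ ⊓ V₂) = a₂₂) ∧
    (finrank F V₁ = d₁ ∧ finrank F V₂ = d₂ ∧ V₁ ⊓ V₂ = ⊥)

section Coordinates

variable {F V W : Type*} [Field F] [AddCommGroup V] [Module F V] [AddCommGroup W] [Module F W]

theorem Submodule.prod_inf_prod' (A A' : Submodule F V) (B B' : Submodule F W) :
    A.prod B ⊓ A'.prod B' = (A ⊓ A').prod (B ⊓ B') := by
  ext x
  simp only [Submodule.mem_inf, Submodule.mem_prod]
  tauto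

theorem Submodule.finrank_prod [FiniteDimensional F V] [FiniteDimensional F W]
    (A : Submodule F V) (B : Submodule F W) :
    finrank F (A.prod B) = finrank F A + finrank F B := by
  rw [← Module.finrank_prod]
  exact LinearEquiv.finrank_eq
    { toFun := fun x => (⟨x.1.1, x.2.1⟩, ⟨x.1.2, x.2.2⟩)
      invFun := fun x => ⟨(x.1.1, x.2.1), x.1.2, x.2.2⟩
      map_add' := fun _ _ => rfl
      map_smul' := fun _ _ => rfl
      left_inv := fun _ => rfl
      right_inv := fun _ => rfl }

theorem Submodule.exists_relative_compl {A B : Submodule F V} (h : A ≤ B) :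
    ∃ C ≤ B, A ⊓ C = ⊥ ∧ A ⊔ C = B := by
  obtain ⟨Q, hQ⟩ := A.exists_isCompl
  refine ⟨Q ⊓ B, inf_le_right, ?_, ?_⟩
  · rw [← inf_assoc, hQ.inf_eq_bot, bot_inf_eq]
  · rw [← sup_inf_assoc_of_le Q h, hQ.sup_eq_top, top_inf_eq]

/-- Two subspaces split the ambient space into four coordinate blocks. -/
theorem exists_coordinates [FiniteDimensional F V] (U₁ U₂ : Submodule F V) {t p₁ p₂ w : ℕ}
    (hV : finrank F V = t + p₁ + p₂ + w) (ht : finrank F ↥(U₁ ⊓ U₂) = t)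
    (h₁ : finrank F U₁ = t + p₁) (h₂ : finrank F U₂ = t + p₂) :
    ∃ e : ((Fin t → F) × (Fin p₁ → F) × (Fin p₂ → F) × (Fin w → F)) ≃ₗ[F] V,
      (∀ x, e x ∈ U₁ ↔ x.2.2.1 = 0 ∧ x.2.2.2 = 0) ∧
      (∀ x, e x ∈ U₂ ↔ x.2.1 = 0 ∧ x.2.2.2 = 0) := by
  obtain ⟨P₁, hP₁, hi₁, hs₁⟩ := Submodule.exists_relative_compl (inf_le_left : U₁ ⊓ U₂ ≤ U₁)
  obtain ⟨P₂, hP₂, hi₂, hs₂⟩ := Submodule.exists_relative_compl (inf_le_right : U₁ ⊓ U₂ ≤ U₂)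
  obtain ⟨W, hW⟩ := (U₁ ⊔ U₂).exists_isCompl
  have d₁ := Submodule.finrank_sup_add_finrank_inf_eq (U₁ ⊓ U₂) P₁
  have d₂ := Submodule.finrank_sup_add_finrank_inf_eq (U₁ ⊓ U₂) P₂
  have d₃ := Submodule.finrank_sup_add_finrank_inf_eq U₁ U₂
  have d₄ := Submodule.finrank_add_eq_of_isCompl hW
  rw [hi₁, hs₁, finrank_bot] at d₁
  rw [hi₂, hs₂, finrank_bot] at d₂
  have eT : (Fin t → F) ≃ₗ[F] ↥(U₁ ⊓ U₂) := LinearEquiv.ofFinrankEq _ _ (by simp [ht])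
  have eP₁ : (Fin p₁ → F) ≃ₗ[F] P₁ := LinearEquiv.ofFinrankEq _ _ (by simp; omega)
  have eP₂ : (Fin p₂ → F) ≃ₗ[F] P₂ := LinearEquiv.ofFinrankEq _ _ (by simp; omega)
  have eW : (Fin w → F) ≃ₗ[F] W := LinearEquiv.ofFinrankEq _ _ (by simp; omega)
  let φ : ((Fin t → F) × (Fin p₁ → F) × (Fin p₂ → F) × (Fin w → F)) →ₗ[F] V :=
    ((U₁ ⊓ U₂).subtype ∘ₗ eT.toLinearMap).coprod
      ((P₁.subtype ∘ₗ eP₁.toLinearMap).coprod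
        ((P₂.subtype ∘ₗ eP₂.toLinearMap).coprod (W.subtype ∘ₗ eW.toLinearMap)))
  have hφ (x) : φ x = eT x.1 + (eP₁ x.2.1 + (eP₂ x.2.2.1 + eW x.2.2.2)) := rfl
  have hW0 (c) (h : (eW c : V) ∈ U₁ ⊔ U₂) : c = 0 := by
    have : (eW c : V) ∈ (U₁ ⊔ U₂) ⊓ W := ⟨h, (eW c).2⟩
    rw [hW.inf_eq_bot, Submodule.mem_bot] at this
    simpa using this
  have hP₁0 (a) (h : (eP₁ a : V) ∈ U₂) : a = 0 := by
    have : (eP₁ a : V) ∈ (U₁ ⊓ U₂) ⊓ P₁ := ⟨⟨hP₁ (eP₁ a).2, h⟩, (eP₁ a).2⟩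
    rw [hi₁, Submodule.mem_bot] at this
    simpa using this
  have hP₂0 (b) (h : (eP₂ b : V) ∈ U₁) : b = 0 := by
    have : (eP₂ b : V) ∈ (U₁ ⊓ U₂) ⊓ P₂ := ⟨⟨h, hP₂ (eP₂ b).2⟩, (eP₂ b).2⟩
    rw [hi₂, Submodule.mem_bot] at this
    simpa using this
  have mT₁ (x) : (eT x : V) ∈ U₁ := (eT x).2.1
  have mT₂ (x) : (eT x : V) ∈ U₂ := (eT x).2.2
  have mP₁ (x) : (eP₁ x : V) ∈ U₁ := hP₁ (eP₁ x).2
  have mP₂ (x) : (eP₂ x : V) ∈ U₂ := hP₂ (eP₂ x).2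
  have hWφ (x) (h : φ x ∈ U₁ ⊔ U₂) : x.2.2.2 = 0 := by
    apply hW0
    rw [hφ, ← add_assoc, ← add_assoc] at h
    refine (Submodule.add_mem_iff_right _ ?_).1 h
    exact add_mem (add_mem (Submodule.mem_sup_left (mT₁ _)) (Submodule.mem_sup_left (mP₁ _)))
      (Submodule.mem_sup_right (mP₂ _))
  have h₁φ (x) : φ x ∈ U₁ ↔ x.2.2.1 = 0 ∧ x.2.2.2 = 0 := by
    constructor
    · intro h
      have hw := hWφ x (Submodule.mem_sup_left h)
      refine ⟨hP₂0 _ ?_, hw⟩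
      rw [hφ, hw, map_zero, Submodule.coe_zero, add_zero, ← add_assoc] at h
      exact (Submodule.add_mem_iff_right _ (add_mem (mT₁ _) (mP₁ _))).1 h
    · rintro ⟨h, h'⟩
      rw [hφ, h, h']
      simpa using add_mem (mT₁ x.1) (mP₁ x.2.1)
  have h₂φ (x) : φ x ∈ U₂ ↔ x.2.1 = 0 ∧ x.2.2.2 = 0 := by
    constructor
    · intro h
      have hw := hWφ x (Submodule.mem_sup_right h)
      refine ⟨hP₁0 _ ?_, hw⟩
      rw [hφ, hw, map_zero, Submodule.coe_zero, add_zero, add_left_comm] at h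
      exact (Submodule.add_mem_iff_left _ (add_mem (mT₂ _) (mP₂ _))).1 h
    · rintro ⟨h, h'⟩
      rw [hφ, h, h']
      simpa using add_mem (mT₂ x.1) (mP₂ x.2.2.1)
  have hinj : Function.Injective φ := by
    rw [← LinearMap.ker_eq_bot, LinearMap.ker_eq_bot']
    intro x hx
    obtain ⟨hb, hc⟩ := (h₁φ x).1 (hx ▸ zero_mem _)
    obtain ⟨ha, -⟩ := (h₂φ x).1 (hx ▸ zero_mem _)
    have hT : x.1 = 0 := by
      rw [hφ, ha, hb, hc] at hx
      simpa using hx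
    exact Prod.ext hT (Prod.ext ha (Prod.ext hb hc))
  exact ⟨LinearMap.linearEquivOfInjective φ hinj (by simp; omega), h₁φ, h₂φ⟩

end Coordinates

namespace Realizable

universe u

variable {F : Type u} [Field F]

/-- A pattern realized somewhere is realized around any two subspaces in that position. -/
theorem exists_decomposition {t p₁ p₂ w a₁₁ a₁₂ a₂₁ a₂₂ d₁ d₂ : ℕ}
    (h : Realizable F t p₁ p₂ w a₁₁ a₁₂ a₂₁ a₂₂ d₁ d₂)
    {V : Type*} [AddCommGroup V] [Module F V] [FiniteDimensional F V] (U₁ U₂ : Submodule F V)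
    (hV : finrank F V = t + p₁ + p₂ + w) (ht : finrank F ↥(U₁ ⊓ U₂) = t)
    (h₁ : finrank F U₁ = t + p₁) (h₂ : finrank F U₂ = t + p₂) :
    ∃ V₁ V₂ : Submodule F V,
      (finrank F V₁ = d₁ ∧ finrank F V₂ = d₂ ∧ V₁ ⊓ V₂ = ⊥ ∧ V₁ ⊔ V₂ = ⊤) ∧
      (finrank F ↥(U₁ ⊓ V₁) = a₁₁ ∧ finrank F ↥(U₁ ⊓ V₂) = a₁₂) ∧
      (finrank F ↥(U₂ ⊓ V₁) = a₂₁ ∧ finrank F ↥(U₂ ⊓ V₂) = a₂₂) := by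
  obtain ⟨X, _, _, _, A₁, A₂, X₁, X₂, ⟨hX, hX'⟩, ⟨hA, hA₁, hA₂⟩, ⟨h₁₁, h₁₂⟩, ⟨h₂₁, h₂₂⟩,
    hX₁, hX₂, hdisj⟩ := h
  obtain ⟨e, he₁, he₂⟩ := exists_coordinates U₁ U₂ hV ht h₁ h₂
  obtain ⟨f, hf₁, hf₂⟩ := exists_coordinates A₁ A₂ hX hA hA₁ hA₂
  let g : X ≃ₗ[F] V := f.symm.trans e
  have hg₁ : A₁.map g.toLinearMap = U₁ := by
    ext v
    obtain ⟨x, rfl⟩ := e.surjective v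
    rw [Submodule.mem_map_equiv, he₁, ← hf₁]
    simp [g]
  have hg₂ : A₂.map g.toLinearMap = U₂ := by
    ext v
    obtain ⟨x, rfl⟩ := e.surjective v
    rw [Submodule.mem_map_equiv, he₂, ← hf₂]
    simp [g]
  have hinf (A B : Submodule F X) :
      A.map g.toLinearMap ⊓ B.map g.toLinearMap = (A ⊓ B).map g.toLinearMap :=
    (Submodule.map_inf _ g.injective).symm
  have hdisj' : X₁.map g.toLinearMap ⊓ X₂.map g.toLinearMap = ⊥ := by
    rw [hinf, hdisj, Submodule.map_bot]
  refine ⟨X₁.map g.toLinearMap, X₂.map g.toLinearMap, ⟨?_, ?_, hdisj', ?_⟩, ?_⟩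
  · rwa [g.finrank_map_eq]
  · rwa [g.finrank_map_eq]
  · apply Submodule.eq_top_of_finrank_eq
    have := Submodule.finrank_sup_add_finrank_inf_eq
      (X₁.map g.toLinearMap) (X₂.map g.toLinearMap)
    rw [hdisj', finrank_bot, g.finrank_map_eq, g.finrank_map_eq] at this
    omega
  · rw [← hg₁, ← hg₂]
    rw [hinf, hinf, hinf, hinf, g.finrank_map_eq, g.finrank_map_eq, g.finrank_map_eq,
      g.finrank_map_eq]
    exact ⟨⟨h₁₁, h₁₂⟩, h₂₁, h₂₂⟩

theorem add {t p₁ p₂ w a₁₁ a₁₂ a₂₁ a₂₂ d₁ d₂ t' p₁' p₂' w' a₁₁' a₁₂' a₂₁' a₂₂' d₁' d₂' : ℕ}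
    (h : Realizable F t p₁ p₂ w a₁₁ a₁₂ a₂₁ a₂₂ d₁ d₂)
    (h' : Realizable F t' p₁' p₂' w' a₁₁' a₁₂' a₂₁' a₂₂' d₁' d₂') :
    Realizable F (t + t') (p₁ + p₁') (p₂ + p₂') (w + w') (a₁₁ + a₁₁') (a₁₂ + a₁₂')
      (a₂₁ + a₂₁') (a₂₂ + a₂₂') (d₁ + d₁') (d₂ + d₂') := by
  obtain ⟨X, _, _, _, A₁, A₂, X₁, X₂, ⟨hX, hX'⟩, ⟨hA, hA₁, hA₂⟩, ⟨h₁₁, h₁₂⟩, ⟨h₂₁, h₂₂⟩,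
    hX₁, hX₂, hdisj⟩ := h
  obtain ⟨Y, _, _, _, B₁, B₂, Y₁, Y₂, ⟨hY, hY'⟩, ⟨hB, hB₁, hB₂⟩, ⟨k₁₁, k₁₂⟩, ⟨k₂₁, k₂₂⟩,
    hY₁, hY₂, hdisj'⟩ := h'
  refine ⟨X × Y, inferInstance, inferInstance, inferInstance,
    A₁.prod B₁, A₂.prod B₂, X₁.prod Y₁, X₂.prod Y₂, ⟨?_, ?_⟩, ⟨?_, ?_, ?_⟩, ⟨?_, ?_⟩, ⟨?_, ?_⟩,
    ?_, ?_, ?_⟩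
  · rw [Module.finrank_prod]; omega
  · rw [Module.finrank_prod]; omega
  · rw [Submodule.prod_inf_prod', Submodule.finrank_prod, hA, hB]
  · rw [Submodule.finrank_prod]; omega
  · rw [Submodule.finrank_prod]; omega
  · rw [Submodule.prod_inf_prod', Submodule.finrank_prod, h₁₁, k₁₁]
  · rw [Submodule.prod_inf_prod', Submodule.finrank_prod, h₁₂, k₁₂]
  · rw [Submodule.prod_inf_prod', Submodule.finrank_prod, h₂₁, k₂₁]
  · rw [Submodule.prod_inf_prod', Submodule.finrank_prod, h₂₂, k₂₂]
  · rw [Submodule.finrank_prod, hX₁, hY₁]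
  · rw [Submodule.finrank_prod, hX₂, hY₂]
  · rw [Submodule.prod_inf_prod', hdisj, hdisj', Submodule.prod_bot]

theorem zero : Realizable F 0 0 0 0 0 0 0 0 0 0 :=
  ⟨PUnit, inferInstance, inferInstance, inferInstance, ⊥, ⊥, ⊥, ⊥,
    by simp [finrank_zero_of_subsingleton]⟩

theorem nsmul {t p₁ p₂ w a₁₁ a₁₂ a₂₁ a₂₂ d₁ d₂ : ℕ}
    (h : Realizable F t p₁ p₂ w a₁₁ a₁₂ a₂₁ a₂₂ d₁ d₂) (n : ℕ) :
    Realizable F (n * t) (n * p₁) (n * p₂) (n * w) (n * a₁₁) (n * a₁₂) (n * a₂₁) (n * a₂₂)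
      (n * d₁) (n * d₂) := by
  induction n with
  | zero => simpa using zero
  | succ n ih => simpa only [Nat.succ_mul] using ih.add h

theorem swap_subspaces {t p₁ p₂ w a₁₁ a₁₂ a₂₁ a₂₂ d₁ d₂ : ℕ}
    (h : Realizable F t p₁ p₂ w a₁₁ a₁₂ a₂₁ a₂₂ d₁ d₂) :
    Realizable F t p₂ p₁ w a₂₁ a₂₂ a₁₁ a₁₂ d₁ d₂ := by
  obtain ⟨X, _, _, _, A₁, A₂, X₁, X₂, ⟨hX, hX'⟩, ⟨hA, hA₁, hA₂⟩, h₁, h₂, h₃⟩ := h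
  refine ⟨X, _, _, ‹_›, A₂, A₁, X₁, X₂, ⟨by omega, hX'⟩, ⟨?_, hA₂, hA₁⟩, h₂, h₁, h₃⟩
  rwa [inf_comm]

theorem swap_parts {t p₁ p₂ w a₁₁ a₁₂ a₂₁ a₂₂ d₁ d₂ : ℕ}
    (h : Realizable F t p₁ p₂ w a₁₁ a₁₂ a₂₁ a₂₂ d₁ d₂) :
    Realizable F t p₁ p₂ w a₁₂ a₁₁ a₂₂ a₂₁ d₂ d₁ := by
  obtain ⟨X, _, _, _, A₁, A₂, X₁, X₂, ⟨hX, hX'⟩, hA, h₁, h₂, h₃, h₄, h₅⟩ := h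
  refine ⟨X, _, _, ‹_›, A₁, A₂, X₂, X₁, ⟨hX, by omega⟩, hA, h₁.symm, h₂.symm, h₄, h₃, ?_⟩
  rwa [inf_comm]

/-- A line of `U₁ ∩ U₂` lying in `V₁`. -/
theorem common_line : Realizable F 1 0 0 0 1 0 1 0 1 0 :=
  ⟨F, inferInstance, inferInstance, inferInstance, ⊤, ⊤, ⊤, ⊥, by rw [inf_idem]; simp⟩

/-- A line of `U₁`, outside `U₂`, lying in `V₁`. -/
theorem exclusive_line : Realizable F 0 1 0 0 1 0 0 0 1 0 :=
  ⟨F, inferInstance, inferInstance, inferInstance, ⊤, ⊥, ⊤, ⊥, by rw [inf_idem]; simp⟩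

/-- A line outside `U₁ + U₂` lying in `V₁`. -/
theorem free_line : Realizable F 0 0 0 1 0 0 0 0 1 0 :=
  ⟨F, inferInstance, inferInstance, inferInstance, ⊥, ⊥, ⊤, ⊥, by simp⟩

theorem finrank_graph_inf_graph {X Y : Type*} [AddCommGroup X] [Module F X]
    [AddCommGroup Y] [Module F Y] (g h : X →ₗ[F] Y) :
    finrank F ↥(g.graph ⊓ h.graph) = finrank F (LinearMap.ker (g - h)) := by
  have hinj : Function.Injective (LinearMap.id.prod g : X →ₗ[F] X × Y) :=
    fun x y hxy => congrArg Prod.fst hxy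
  have hmap : g.graph ⊓ h.graph = (LinearMap.ker (g - h)).map (LinearMap.id.prod g) := by
    ext ⟨x, y⟩
    simp only [Submodule.mem_inf, LinearMap.mem_graph_iff, Submodule.mem_map, LinearMap.mem_ker,
      LinearMap.sub_apply, sub_eq_zero]
    constructor
    · rintro ⟨hg, hh⟩
      exact ⟨x, hg.symm.trans hh, Prod.ext rfl hg.symm⟩
    · rintro ⟨z, hz, hzx⟩
      obtain rfl : z = x := congrArg Prod.fst hzx
      have hg : y = g z := (congrArg Prod.snd hzx).symm
      exact ⟨hg, hg.trans hz⟩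
  rw [hmap, (Submodule.equivMapOfInjective _ hinj (LinearMap.ker (g - h))).finrank_eq]

theorem finrank_graph {X Y : Type*} [AddCommGroup X] [Module F X]
    [AddCommGroup Y] [Module F Y] (g : X →ₗ[F] Y) : finrank F g.graph = finrank F X := by
  rw [← inf_idem g.graph, finrank_graph_inf_graph, sub_self, LinearMap.ker_zero, finrank_top]

theorem graph_inf_vertical {X Y : Type*} [AddCommGroup X] [Module F X]
    [AddCommGroup Y] [Module F Y] (g : X →ₗ[F] Y) :
    g.graph ⊓ (⊥ : Submodule F X).prod ⊤ = ⊥ := by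
  rw [eq_bot_iff]
  rintro ⟨x, y⟩ ⟨h, h', -⟩
  obtain rfl : x = 0 := h'
  simpa [LinearMap.mem_graph_iff] using h

/-- The graphs of two linear maps `X → Y` against the decomposition `X ⊕ Y`. -/
theorem of_graphs {X Y : Type u} [AddCommGroup X] [Module F X] [FiniteDimensional F X]
    [AddCommGroup Y] [Module F Y] [FiniteDimensional F Y] (g h : X →ₗ[F] Y) {t p w a b : ℕ}
    (hX : finrank F X = t + p) (hY : finrank F Y = p + w)
    (ht : finrank F (LinearMap.ker (g - h)) = t) (ha : finrank F (LinearMap.ker g) = a)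
    (hb : finrank F (LinearMap.ker h) = b) :
    Realizable F t p p w a 0 b 0 (t + p) (p + w) := by
  refine ⟨X × Y, inferInstance, inferInstance, inferInstance, g.graph, h.graph,
    (0 : X →ₗ[F] Y).graph, (⊥ : Submodule F X).prod ⊤,
    ⟨?_, ?_⟩, ⟨?_, ?_, ?_⟩, ⟨?_, ?_⟩, ⟨?_, ?_⟩, ?_, ?_, ?_⟩
  · rw [Module.finrank_prod]; omega
  · rw [Module.finrank_prod, hX, hY]
  · rw [finrank_graph_inf_graph, ht]
  · rw [finrank_graph, hX]
  · rw [finrank_graph, hX]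
  · rw [finrank_graph_inf_graph, sub_zero, ha]
  · rw [graph_inf_vertical, finrank_bot]
  · rw [finrank_graph_inf_graph, sub_zero, hb]
  · rw [graph_inf_vertical, finrank_bot]
  · rw [finrank_graph, hX]
  · rw [Submodule.finrank_prod, finrank_bot, finrank_top, hY, zero_add]
  · rw [graph_inf_vertical]

theorem finrank_ker_id {X : Type*} [AddCommGroup X] [Module F X] :
    finrank F (LinearMap.ker (LinearMap.id : X →ₗ[F] X)) = 0 := by
  rw [LinearMap.ker_id, finrank_bot]

theorem finrank_ker_eq_zero {X Y : Type*} [AddCommGroup X] [Module F X]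
    [AddCommGroup Y] [Module F Y] (g : X →ₗ[F] Y) (h : ∀ x, g x = 0 → x = 0) :
    finrank F (LinearMap.ker g) = 0 := by
  rw [LinearMap.ker_eq_bot'.2 h, finrank_bot]

/-- A generic line of `U₁ ∩ U₂`. -/
theorem generic_common_line : Realizable F 1 0 0 1 0 0 0 0 1 1 :=
  of_graphs (X := F) (Y := F) LinearMap.id LinearMap.id (by simp) (by simp)
    (by rw [sub_self, LinearMap.ker_zero, finrank_top, finrank_self])
    finrank_ker_id finrank_ker_id

/-- A generic line of `U₁` paired with a line of `U₂` lying in `V₂`. -/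
theorem half_generic_pair : Realizable F 0 1 1 0 0 0 0 1 1 1 :=
  (of_graphs (X := F) (Y := F) LinearMap.id 0 (by simp) (by simp)
    (by rw [sub_zero, finrank_ker_id]) finrank_ker_id
    (by rw [LinearMap.ker_zero, finrank_top, finrank_self])).swap_parts

theorem generic_pair_of_card_ne_two [Fintype F] (h : Fintype.card F ≠ 2) :
    Realizable F 0 1 1 0 0 0 0 0 1 1 := by
  obtain ⟨c, hc₀, hc₁⟩ : ∃ c : F, c ≠ 0 ∧ c ≠ 1 := by
    classical
    have hlt : ({0, 1} : Finset F).card < Fintype.card F := by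
      rw [Finset.card_pair zero_ne_one]
      have := Fintype.one_lt_card (α := F)
      omega
    obtain ⟨c, -, hc⟩ := Finset.exists_mem_notMem_of_card_lt_card (t := Finset.univ) hlt
    simp only [Finset.mem_insert, Finset.mem_singleton, not_or] at hc
    exact ⟨c, hc⟩
  refine of_graphs (X := F) (Y := F) LinearMap.id (c • LinearMap.id) (by simp) (by simp)
    (finrank_ker_eq_zero _ fun x hx => ?_) finrank_ker_id (finrank_ker_eq_zero _ fun x hx => ?_)
  · have : (1 - c) * x = 0 := by simpa [sub_mul] using hx
    exact (mul_eq_zero.1 this).resolve_left (sub_ne_zero.2 hc₁.symm)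
  · simpa [hc₀] using hx

theorem two_generic_pairs : Realizable F 0 2 2 0 0 0 0 0 2 2 := by
  let g : F × F →ₗ[F] F × F :=
    (LinearMap.snd F F F).prod (LinearMap.fst F F F + LinearMap.snd F F F)
  refine of_graphs (X := F × F) (Y := F × F) LinearMap.id g (by simp) (by simp)
    (finrank_ker_eq_zero _ ?_) finrank_ker_id (finrank_ker_eq_zero _ ?_)
  all_goals
    rintro ⟨x, y⟩ h
    simp [g] at h ⊢
    grind

theorem three_generic_pairs : Realizable F 0 3 3 0 0 0 0 0 3 3 := by
  let g : F × F × F →ₗ[F] F × F × F :=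
    (LinearMap.fst F F F ∘ₗ LinearMap.snd F F (F × F)).prod
      ((LinearMap.snd F F F ∘ₗ LinearMap.snd F F (F × F)).prod
        (LinearMap.fst F F (F × F) + LinearMap.fst F F F ∘ₗ LinearMap.snd F F (F × F)))
  refine of_graphs (X := F × F × F) (Y := F × F × F) LinearMap.id g (by simp) (by simp)
    (finrank_ker_eq_zero _ ?_) finrank_ker_id (finrank_ker_eq_zero _ ?_)
  all_goals
    rintro ⟨x, y, z⟩ h
    simp [g] at h ⊢
    grind

/-- A generic pair of lines with the help of a line outside `U₁ + U₂`. -/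
theorem generic_pair_with_free_line : Realizable F 0 1 1 1 0 0 0 0 2 1 := by
  refine (of_graphs (X := F) (Y := F × F) (LinearMap.inl F F F) (LinearMap.inr F F F)
    (by simp) (by simp) (finrank_ker_eq_zero _ ?_) (finrank_ker_eq_zero _ ?_)
    (finrank_ker_eq_zero _ ?_)).swap_parts
  all_goals
    intro x h
    simpa using h

/-- A generic pair of lines with the help of a generic line of `U₁ ∩ U₂`. -/
theorem generic_pair_with_common_line : Realizable F 1 1 1 1 0 0 0 0 2 2 := by
  let g : F × F →ₗ[F] F × F :=
    (LinearMap.fst F F F).prod (LinearMap.fst F F F + LinearMap.snd F F F)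
  have hker : LinearMap.ker (LinearMap.id - g) = (⊥ : Submodule F F).prod ⊤ := by
    ext ⟨x, y⟩
    simp [g]
  refine of_graphs (X := F × F) (Y := F × F) LinearMap.id g (by simp) (by simp)
    ?_ finrank_ker_id (finrank_ker_eq_zero _ ?_)
  · rw [hker, Submodule.finrank_prod, finrank_bot, finrank_top, finrank_self]
  · rintro ⟨x, y⟩ h
    simp [g] at h ⊢
    grind

theorem generic_pairs_of_ne_one {n : ℕ} (h : n ≠ 1) : Realizable F 0 n n 0 0 0 0 0 n n := by
  obtain ⟨m, rfl | rfl⟩ := n.even_or_odd'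
  · convert (two_generic_pairs (F := F)).nsmul m using 1 <;> omega
  · convert ((two_generic_pairs (F := F)).nsmul (m - 1)).add three_generic_pairs using 1 <;> omega

theorem generic_pairs [Fintype F] {n : ℕ} (h : n ≠ 1 ∨ Fintype.card F ≠ 2) :
    Realizable F 0 n n 0 0 0 0 0 n n := by
  obtain h | h := h
  · exact generic_pairs_of_ne_one h
  · simpa using (generic_pair_of_card_ne_two h).nsmul n

theorem generic_pairs_with_free_line (n : ℕ) : Realizable F 0 n n 1 0 0 0 0 (n + 1) n := by
  by_cases h : n = 1
  · subst h
    exact generic_pair_with_free_line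
  · exact (generic_pairs_of_ne_one h).add free_line

/-- Any numbers of lines, each inside one of `V₁, V₂`, plus generic lines of `U₁ ∩ U₂`. -/
theorem lines (c₁ c₂ b₁₁ b₁₂ b₂₁ b₂₂ z x y : ℕ) :
    Realizable F (c₁ + c₂ + z) (b₁₁ + b₁₂) (b₂₁ + b₂₂) (z + x + y)
      (c₁ + b₁₁) (c₂ + b₁₂) (c₁ + b₂₁) (c₂ + b₂₂)
      (c₁ + b₁₁ + b₂₁ + z + x) (c₂ + b₁₂ + b₂₂ + z + y) := by
  convert ((((((((common_line (F := F)).nsmul c₁).add (common_line.swap_parts.nsmul c₂)).add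
    (exclusive_line.nsmul b₁₁)).add (exclusive_line.swap_parts.nsmul b₁₂)).add
    (exclusive_line.swap_subspaces.nsmul b₂₁)).add
    (exclusive_line.swap_subspaces.swap_parts.nsmul b₂₂)).add
    (generic_common_line.nsmul z)).add
    ((free_line.nsmul x).add (free_line.swap_parts.nsmul y)) using 1 <;> omega

/-- `U₁` and `U₂` can be met in the pattern `(k₁, k₂)` and `(k₂, k₁)`. -/
theorem opposite [Fintype F] {t p w k k₁ k₂ : ℕ} (hk : k₁ ≤ k₂) (hlow : k₁ + k₂ ≤ t + p)
    (hpk : t + p ≤ k) (hw : t + p + p + w = 2 * k) (hk₂ : k₂ ≤ p + k₁)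
    (hexc : ¬(Fintype.card F = 2 ∧ k₁ = 0 ∧ t = 0 ∧ k = p ∧ p = k₂ + 1)) :
    Realizable F t p p w k₁ k₂ k₂ k₁ k k := by
  obtain hp | hp := lt_or_ge p (k₁ + k₂)
  · obtain ⟨c₁, c₂, h₁, h₂, hc⟩ : ∃ c₁ c₂, c₁ ≤ k₁ ∧ c₂ ≤ k₁ ∧ c₁ + c₂ + p = k₁ + k₂ :=
      ⟨min (k₁ + k₂ - p) k₁, k₁ + k₂ - p - min (k₁ + k₂ - p) k₁, by omega, by omega, by omega⟩
    convert lines (F := F) c₁ c₂ (k₁ - c₁) (k₂ - c₂) (k₂ - c₁) (k₁ - c₂) (t - (c₁ + c₂))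
      (k - (t + p) + c₁) (k - (t + p) + c₂) using 1 <;> omega
  obtain ⟨n, rfl⟩ := Nat.exists_eq_add_of_le hp
  by_cases hn : n ≠ 1 ∨ Fintype.card F ≠ 2
  · convert (lines (F := F) 0 0 k₁ k₂ k₂ k₁ t (k - (t + (k₁ + k₂ + n)))
      (k - (t + (k₁ + k₂ + n)))).add (generic_pairs hn) using 1 <;> omega
  push Not at hn
  obtain ⟨rfl, hq⟩ := hn
  obtain hlt | heq := hpk.lt_or_eq
  · convert (lines (F := F) 0 0 k₁ k₂ k₂ k₁ t (k - (t + (k₁ + k₂ + 1)) - 1)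
      (k - (t + (k₁ + k₂ + 1)))).add (generic_pairs_with_free_line 1) using 1 <;> omega
  obtain rfl | ht := t.eq_zero_or_pos
  · convert (lines (F := F) 0 0 (k₁ - 1) k₂ k₂ (k₁ - 1) 0 0 0).add
      (half_generic_pair.add half_generic_pair.swap_parts.swap_subspaces)
      using 1 <;> omega
  · convert (lines (F := F) 0 0 k₁ k₂ k₂ k₁ (t - 1) 0 0).add generic_pair_with_common_line
      using 1 <;> omega

/-- `U₁` and `U₂` can both be met in the pattern `(k₁, k₂)`. -/
theorem parallel {t p w k k₁ k₂ : ℕ} (hlow : k₁ + k₂ ≤ t + p) (hpk : t + p ≤ k)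
    (hw : t + p + p + w = 2 * k) (hk₂ : p + k₁ < k₂) (ht : 2 * k₂ ≤ k + t) :
    Realizable F t p p w k₁ k₂ k₁ k₂ k k := by
  obtain htk | htk := lt_or_ge t k₂
  · obtain ⟨n, hn⟩ := Nat.exists_eq_add_of_le hlow
    obtain ⟨h, hh⟩ : ∃ h, h = min n (k₂ - t) := ⟨_, rfl⟩
    have hV₁ : 2 * k₁ + h + n < k := by omega
    have hV₂ : t + 2 * (k₂ - t - h) + h + n ≤ k := by omega
    convert ((lines (F := F) 0 t k₁ (k₂ - t - h) k₁ (k₂ - t - h) 0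
      (k - (2 * k₁ + h + n) - 1) (k - (t + 2 * (k₂ - t - h) + h + n))).add
      ((half_generic_pair.nsmul h).add (half_generic_pair.swap_subspaces.nsmul h))).add
      (generic_pairs_with_free_line (n - h)) using 1 <;> omega
  obtain hle | hlt := le_or_gt (k₁ + k₂) t
  · convert (lines (F := F) k₁ k₂ 0 0 0 0 (t - k₁ - k₂) (k - (t + p) + k₂ - 1)
      (k - (t + p) + k₁)).add (generic_pairs_with_free_line p) using 1 <;> omega
  · convert (lines (F := F) (t - k₂) k₂ (k₁ + k₂ - t) 0 (k₁ + k₂ - t) 0 0 (k - k₁ - p - 1)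
      (k - (t + p) + k₁)).add (generic_pairs_with_free_line (t + p - k₁ - k₂)) using 1 <;> omega

end Realizable

theorem exists_common_bisection_or_exceptional
    (F V : Type*) [Field F] [Fintype F] [AddCommGroup V] [Module F V]
    [FiniteDimensional F V] (q k m k₁ k₂ t : ℕ)
    (hq : Fintype.card F = q) (hk : 1 ≤ k) (hV : finrank F V = 2 * k)
    (hk₁₂ : k₁ ≤ k₂) (hmlow : k₁ + k₂ ≤ m) (hmk : m ≤ k)
    (ht : t < m)
    (U₁ U₂ : Submodule F V) (hU₁ : finrank F U₁ = m) (hU₂ : finrank F U₂ = m)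
    (hU₁₂ : finrank F ↥(U₁ ⊓ U₂) = t) :
    (∃ V₁ V₂ : Submodule F V, IsBisection k V₁ V₂ ∧
        Incident k₁ k₂ U₁ V₁ V₂ ∧ Incident k₁ k₂ U₂ V₁ V₂) ∨
    (q = 2 ∧ k₁ = 0 ∧ t = 0 ∧ k = m ∧ m = k₂ + 1) ∨
    (k + 1 + m + k₁ < 3 * k₂ ∧ m + k₁ < t + k₂) := by
  obtain ⟨p, rfl⟩ := Nat.exists_eq_add_of_lt ht
  set r := p + 1 with hr
  have hw : t + r + r + (2 * k - 2 * r - t) = 2 * k := by omega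
  rw [or_iff_not_imp_right]
  intro h
  push Not at h
  obtain ⟨hexc, hc⟩ := h
  obtain hle | hlt := le_or_gt k₂ (r + k₁)
  · obtain ⟨V₁, V₂, hV', h₁, h₂⟩ := (Realizable.opposite (F := F) (t := t) hk₁₂ hmlow hmk hw hle
      (by omega)).exists_decomposition U₁ U₂ (by omega) hU₁₂ hU₁ hU₂
    exact ⟨V₁, V₂, hV', Or.inl h₁, Or.inr h₂⟩
  · obtain ⟨V₁, V₂, hV', h₁, h₂⟩ := (Realizable.parallel (F := F) (t := t) hmlow hmk hw hlt
      (by omega)).exists_decomposition U₁ U₂ (by omega) hU₁₂ hU₁ hU₂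
    exact ⟨V₁, V₂, hV', Or.inl h₁, Or.inl h₂⟩
end

section
/- Let F be a finite field with |F| = q and let V be a 2-dimensional F-vector space, so that a bisection of V is an unordered pair of distinct 1-dimensional subspaces. Then: (i) (for every pair of distinct bisections {V1, V2} and {V1', V2'} of V there exists a 1-dimensional subspace U of V with U ∩ V1 = U ∩ V2 = U ∩ V1' = U ∩ V2' = 0) if and only if q ≥ 4; and (ii) (for every pair of distinct bisections {V1, V2} and {V1', V2'} of V there exists a 1-dimensional subspace U of V such that the unordered pair (dim(U ∩ V1), dim(U ∩ V2)) equals (0, 1) and the unordered pair (dim(U ∩ V1'), dim(U ∩ V2')) equals (0, 1)) if and only if q = 2. -/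
open Module

namespace Finset

variable {α : Type*} {s : Finset α}

theorem forall_pairs_exists_avoiding_iff (hs : 3 ≤ s.card) :
    (∀ a b c d : α, (a ∈ s ∧ b ∈ s ∧ a ≠ b) → (c ∈ s ∧ d ∈ s ∧ c ≠ d) →
      ({a, b} : Set α) ≠ {c, d} →
      ∃ u ∈ s, u ≠ a ∧ u ≠ b ∧ u ≠ c ∧ u ≠ d) ↔ 5 ≤ s.card := by
  classical
  constructor
  · intro h
    by_contra! hlt
    obtain h3 | h4 : s.card = 3 ∨ s.card = 4 := by lia
    · obtain ⟨x, y, z, hxy, hxz, hyz, rfl⟩ := card_eq_three.1 h3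
      have := h x y x z (by simp [hxy]) (by simp [hxz]) (by
        simp only [ne_eq, Set.pair_eq_pair_iff]
        grind)
      grind
    · obtain ⟨x, y, z, w, hxy, hxz, hxw, hyz, hyw, hzw, rfl⟩ := card_eq_four.1 h4
      have := h x y z w (by simp [hxy]) (by simp [hzw]) (by
        simp only [ne_eq, Set.pair_eq_pair_iff]
        grind)
      grind
  · intro h a b c d _ _ _
    obtain ⟨u, hu, hn⟩ := exists_mem_notMem_of_card_lt_card
      (s := {a, b, c, d}) (t := s) (card_le_four.trans_lt h)
    exact ⟨u, hu, by simpa using hn⟩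

theorem forall_pairs_exists_common_iff (hs : 3 ≤ s.card) :
    (∀ a b c d : α, (a ∈ s ∧ b ∈ s ∧ a ≠ b) → (c ∈ s ∧ d ∈ s ∧ c ≠ d) →
      ({a, b} : Set α) ≠ {c, d} →
      ∃ u ∈ s, (u = a ∨ u = b) ∧ (u = c ∨ u = d)) ↔ s.card = 3 := by
  classical
  constructor
  · intro h
    by_contra hne
    obtain ⟨x, hx, y, hy, z, hz, w, hw, hxy, hxz, hxw, hyz, hyw, hzw⟩ :=
      three_lt_card.1 (show 3 < s.card by lia)
    have := h x y z w ⟨hx, hy, hxy⟩ ⟨hz, hw, hzw⟩ (by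
      simp only [ne_eq, Set.pair_eq_pair_iff]
      grind)
    grind
  · intro h a b c d ⟨_, _, _⟩ ⟨_, _, _⟩ _
    obtain ⟨x, y, z, hxy, hxz, hyz, rfl⟩ := card_eq_three.1 h
    by_contra! hn
    grind

end Finset

section Lines

variable {F V : Type*} [Field F] [AddCommGroup V] [Module F V] {A B U : Submodule F V}

theorem Submodule.inf_eq_bot_iff_ne_of_finrank_eq_one
    (hA : finrank F A = 1) (hB : finrank F B = 1) : A ⊓ B = ⊥ ↔ A ≠ B := by
  rw [← Submodule.isAtom_iff_finrank_eq_one] at hA hB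
  refine ⟨?_, fun h => (hA.disjoint_of_ne hB h).eq_bot⟩
  rintro h rfl
  exact hA.1 (by simpa using h)

theorem Submodule.finrank_inf_eq_ite_of_finrank_eq_one [Decidable (A = B)]
    (hA : finrank F A = 1) (hB : finrank F B = 1) :
    finrank F ↥(A ⊓ B) = if A = B then 1 else 0 := by
  split_ifs with h
  · rw [← h, inf_idem, hA]
  · rw [(inf_eq_bot_iff_ne_of_finrank_eq_one hA hB).2 h, finrank_bot]

theorem isBisection_one_iff [FiniteDimensional F V] (hV : finrank F V = 2) :
    IsBisection 1 A B ↔ finrank F A = 1 ∧ finrank F B = 1 ∧ A ≠ B := by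
  refine and_congr_right fun hA => and_congr_right fun hB => ?_
  rw [Submodule.inf_eq_bot_iff_ne_of_finrank_eq_one hA hB, and_iff_left_iff_imp]
  intro h
  have hinf := (Submodule.inf_eq_bot_iff_ne_of_finrank_eq_one hA hB).2 h
  have hsum := Submodule.finrank_sup_add_finrank_inf_eq A B
  rw [hinf, finrank_bot] at hsum
  exact Submodule.eq_top_of_finrank_eq (by lia)

theorem incident_zero_one_iff (hU : finrank F U = 1) (hA : finrank F A = 1)
    (hB : finrank F B = 1) (h : A ≠ B) : Incident 0 1 U A B ↔ U = A ∨ U = B := by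
  classical
  rw [Incident, Submodule.finrank_inf_eq_ite_of_finrank_eq_one hU hA,
    Submodule.finrank_inf_eq_ite_of_finrank_eq_one hU hB]
  grind

variable (F V) in
theorem exists_finset_lines [Finite F] (hV : finrank F V = 2) :
    ∃ s : Finset (Submodule F V),
      (∀ U, U ∈ s ↔ finrank F U = 1) ∧ s.card = Nat.card F + 1 := by
  have hcard : {U : Submodule F V | finrank F U = 1}.ncard = Nat.card F + 1 := by
    rw [← Projectivization.card_of_finrank_two F V hV,
      Nat.card_congr (Projectivization.equivSubmodule F V)]
    rfl
  have hfin := Set.finite_of_ncard_ne_zero (hcard.trans_ne (Nat.succ_ne_zero _))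
  exact ⟨hfin.toFinset, by simp, by rw [← Set.ncard_eq_toFinset_card _ hfin, hcard]⟩

end Lines

theorem concurrent_completeness_k_eq_one
    (F V : Type*) [Field F] [Fintype F] [AddCommGroup V] [Module F V]
    [FiniteDimensional F V] (q : ℕ)
    (hq : Fintype.card F = q) (hV : finrank F V = 2) :
    ((∀ V₁ V₂ V₁' V₂' : Submodule F V,
        IsBisection 1 V₁ V₂ → IsBisection 1 V₁' V₂' →
        ({V₁, V₂} : Set (Submodule F V)) ≠ {V₁', V₂'} →
        ∃ U : Submodule F V, finrank F U = 1 ∧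
          U ⊓ V₁ = ⊥ ∧ U ⊓ V₂ = ⊥ ∧ U ⊓ V₁' = ⊥ ∧ U ⊓ V₂' = ⊥) ↔ 4 ≤ q) ∧
    ((∀ V₁ V₂ V₁' V₂' : Submodule F V,
        IsBisection 1 V₁ V₂ → IsBisection 1 V₁' V₂' →
        ({V₁, V₂} : Set (Submodule F V)) ≠ {V₁', V₂'} →
        ∃ U : Submodule F V, finrank F U = 1 ∧
          Incident 0 1 U V₁ V₂ ∧ Incident 0 1 U V₁' V₂') ↔ q = 2) := by
  obtain ⟨s, hs, hcard⟩ := exists_finset_lines F V hV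
  rw [Nat.card_eq_fintype_card, hq] at hcard
  have hq2 : 1 < q := hq ▸ Fintype.one_lt_card
  have avoiding := Finset.forall_pairs_exists_avoiding_iff (s := s) (by lia)
  have common := Finset.forall_pairs_exists_common_iff (s := s) (by lia)
  rw [hcard] at avoiding common
  simp only [hs] at avoiding common
  simp only [isBisection_one_iff hV]
  constructor
  · rw [show 4 ≤ q ↔ 5 ≤ q + 1 by lia, ← avoiding]
    refine forall₄_congr fun A B C D => forall₂_congr fun hAB hCD => imp_congr_right fun _ =>
      exists_congr fun U => and_congr_right fun hU => ?_
    simp only [Submodule.inf_eq_bot_iff_ne_of_finrank_eq_one hU, hAB.1, hAB.2.1, hCD.1, hCD.2.1]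
  · rw [show q = 2 ↔ q + 1 = 3 by lia, ← common]
    refine forall₄_congr fun A B C D => forall₂_congr fun hAB hCD => imp_congr_right fun _ =>
      exists_congr fun U => and_congr_right fun hU => ?_
    rw [incident_zero_one_iff hU hAB.1 hAB.2.1 hAB.2.2,
      incident_zero_one_iff hU hCD.1 hCD.2.1 hCD.2.2]
end

section
/- Let F be a finite field with |F| = q, let k ≥ 1 with q^k > 4, let V be a 2k-dimensional F-vector space, and let m be an integer with 1 ≤ m ≤ k. Suppose that none of the following holds: (q = 2 and m = k − 1 and m ≥ 2), (q = 2 and m = k and k ≥ 3), (q = 3 and m = k and k ≥ 2), (q = 4 and m = k and k ≥ 3). Then Proj^{m,k}_{(0,0)}(V) is concurrently complete. -/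
open Module

/-- Concurrent completeness of the geometry `Proj^{m,k}_{(0,0)}(V)`. -/
def ConcurrentlyCompleteZero (F V : Type*) [Field F] [AddCommGroup V] [Module F V]
    (m k : ℕ) : Prop :=
  ∀ V₁ V₂ V₁' V₂' : Submodule F V, IsBisection k V₁ V₂ → IsBisection k V₁' V₂' →
    ({V₁, V₂} : Set (Submodule F V)) ≠ {V₁', V₂'} →
    ∃ U : Submodule F V, finrank F U = m ∧
      U ⊓ V₁ = ⊥ ∧ U ⊓ V₂ = ⊥ ∧ U ⊓ V₁' = ⊥ ∧ U ⊓ V₂' = ⊥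

/-- A finite vector space is not covered by few subspaces of large codimension. -/
theorem exists_forall_notMem_submodule {F V ι : Type*} [Field F] [Fintype F] [AddCommGroup V]
    [Module F V] [FiniteDimensional F V] [Fintype ι] (W : ι → Submodule F V) (c : ℕ) (hc : 1 ≤ c)
    (hι : Fintype.card ι ≤ Fintype.card F ^ c)
    (hW : ∀ i, finrank F (W i) + c ≤ finrank F V) : ∃ v, ∀ i, v ∉ W i := by
  classical
  by_contra! h
  have : Fintype V := @Fintype.ofFinite V (Module.finite_of_finite F)
  have hF : 1 < Fintype.card F := Fintype.one_lt_card
  obtain ⟨i₀, -⟩ := h 0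
  have hcn : c ≤ finrank F V := by have := hW i₀; omega
  have hsub : (Finset.univ.erase (0 : V)) ⊆
      Finset.univ.biUnion fun i => (Finset.univ.filter (· ∈ W i)).erase 0 := by
    intro v hv
    obtain ⟨i, hi⟩ := h v
    simp only [Finset.mem_biUnion, Finset.mem_erase, Finset.mem_filter, Finset.mem_univ, true_and,
      and_true] at hv ⊢
    exact ⟨i, hv, hi⟩
  have hcard : ∀ i, ((Finset.univ.filter (· ∈ W i)).erase 0).card ≤
      Fintype.card F ^ (finrank F V - c) - 1 := by
    intro i
    rw [Finset.card_erase_of_mem (by simp), ← Fintype.card_subtype,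
      Module.card_eq_pow_finrank (K := F) (V := W i)]
    have := hW i
    exact Nat.sub_le_sub_right (Nat.pow_le_pow_right hF.le (by omega)) 1
  have hle := (Finset.card_le_card hsub).trans
    (Finset.card_biUnion_le_card_mul _ _ _ fun i _ => hcard i)
  rw [Finset.card_erase_of_mem (Finset.mem_univ _), Finset.card_univ, Finset.card_univ,
    Module.card_eq_pow_finrank (K := F) (V := V)] at hle
  have hle' := hle.trans (Nat.mul_le_mul_right _ hι)
  rw [Nat.mul_sub, ← pow_add, Nat.add_sub_cancel' hcn, mul_one] at hle'
  have h₁ : 1 < Fintype.card F ^ c := Nat.one_lt_pow (by omega) hF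
  have h₂ : Fintype.card F ^ c ≤ Fintype.card F ^ finrank F V := Nat.pow_le_pow_right hF.le hcn
  omega

/-- A small family of subspaces of dimension at most `a` admits a subspace of dimension `m`
disjoint from each of them. -/
theorem exists_finrank_eq_forall_disjoint {F V ι : Type*} [Field F] [Fintype F] [AddCommGroup V]
    [Module F V] [FiniteDimensional F V] [Fintype ι] [Nonempty ι] (A : ι → Submodule F V)
    (a c : ℕ) (hc : 1 ≤ c) (hι : Fintype.card ι ≤ Fintype.card F ^ c)
    (hA : ∀ i, finrank F (A i) ≤ a) (m : ℕ) (hm : a + m + c ≤ finrank F V + 1) :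
    ∃ U : Submodule F V, finrank F U = m ∧ ∀ i, Disjoint U (A i) := by
  induction m with
  | zero => exact ⟨⊥, finrank_bot F V, fun i => disjoint_bot_left⟩
  | succ m ih =>
    obtain ⟨U, hU, hd⟩ := ih (by omega)
    obtain ⟨v, hv⟩ := exists_forall_notMem_submodule (fun i => A i ⊔ U) c hc hι fun i => by
      have h₁ := Submodule.finrank_add_le_finrank_add_finrank (A i) U
      have h₂ := hA i
      omega
    have hv₀ : v ≠ 0 := by
      rintro rfl
      exact hv (Classical.arbitrary ι) (zero_mem _)
    have hdv : ∀ i, Disjoint (A i ⊔ U) (F ∙ v) := fun i =>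
      (Submodule.disjoint_span_singleton' hv₀).2 (hv i)
    refine ⟨U ⊔ F ∙ v, ?_, fun i => ?_⟩
    · have hUv : Disjoint U (F ∙ v) := (hdv (Classical.arbitrary ι)).mono_left le_sup_right
      have h := Submodule.finrank_sup_add_finrank_inf_eq U (F ∙ v)
      rw [hUv.eq_bot, finrank_bot, finrank_span_singleton hv₀, hU] at h
      simpa using h
    · exact ((hd i).symm.disjoint_sup_right_of_disjoint_sup_left (hdv i)).symm

theorem concurrentlyComplete_zero_of_large_q
    (F V : Type*) [Field F] [Fintype F] [AddCommGroup V] [Module F V]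
    [FiniteDimensional F V] (q k m : ℕ)
    (hq : Fintype.card F = q) (hk : 1 ≤ k) (hqk : 4 < q ^ k)
    (hV : finrank F V = 2 * k) (hm1 : 1 ≤ m) (hmk : m ≤ k)
    (h1 : ¬(q = 2 ∧ m = k - 1 ∧ 2 ≤ m))
    (h2 : ¬(q = 2 ∧ m = k ∧ 3 ≤ k))
    (h3 : ¬(q = 3 ∧ m = k ∧ 2 ≤ k))
    (h4 : ¬(q = 4 ∧ m = k ∧ 3 ≤ k)) :
    ConcurrentlyCompleteZero F V m k := by
  intro V₁ V₂ V₁' V₂' hB hB' _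
  have hq1 : 1 < q := hq ▸ Fintype.one_lt_card
  have hcard : 4 ≤ q ^ (k - m + 1) := by
    rcases (by omega : q = 2 ∨ q = 3 ∨ 4 ≤ q) with rfl | rfl | h
    · have hk3 : 3 ≤ k := by
        by_contra! hlt
        interval_cases k <;> omega
      exact le_trans (by norm_num) (Nat.pow_le_pow_right (by norm_num) (by omega : 2 ≤ k - m + 1))
    · have hk2 : 2 ≤ k := by
        by_contra! hlt
        obtain rfl : k = 1 := by omega
        omega
      exact le_trans (by norm_num) (Nat.pow_le_pow_right (by norm_num) (by omega : 2 ≤ k - m + 1))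
    · exact h.trans (Nat.le_self_pow (by omega) q)
  obtain ⟨U, hU, hd⟩ := exists_finrank_eq_forall_disjoint ![V₁, V₂, V₁', V₂'] k (k - m + 1)
    (by omega) (by simpa [hq] using hcard)
    (by simpa [Fin.forall_fin_succ] using ⟨hB.1.le, hB.2.1.le, hB'.1.le, hB'.2.1.le⟩) m (by omega)
  exact ⟨U, hU, (hd 0).eq_bot, (hd 1).eq_bot, (hd 2).eq_bot, (hd 3).eq_bot⟩
end

section
/- Let F be a finite field with |F| = q, let k ≥ 1 with q^k ≥ 4, and let V be a 2k-dimensional F-vector space. Let π1, π2, π3, π4 be k-dimensional subspaces of V with π_i ∩ π_j = 0 for all i ≠ j. Then there exists a k-dimensional subspace σ of V with σ ∩ π_i = 0 for each i ∈ {1, 2, 3, 4}. -/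
open Module

/-- If the scalars have an element other than `0` and `1`, the ratios `Q w / P w` of two linear maps
into an extension field cannot cover all elements other than `0` and `1`. -/
theorem exists_ne_mul_of_injective {F E W : Type*} [Field F] [Field E] [Algebra F E] [Finite E]
    [AddCommGroup W] [Module F W] (hE : 4 ≤ Nat.card E) {P Q : W →ₗ[F] E}
    (hP : Function.Injective P) (hW : Nat.card W = Nat.card E) {a : F} (ha : a ≠ 0) (ha' : a ≠ 1) :
    ∃ c : E, c ≠ 0 ∧ c ≠ 1 ∧ ∀ w, Q w = c * P w → w = 0 := by
  classical
  have : Finite W := Finite.of_injective P hP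
  have := Fintype.ofFinite W
  have := Fintype.ofFinite E
  rw [Nat.card_eq_fintype_card] at hE
  rw [Nat.card_eq_fintype_card, Nat.card_eq_fintype_card] at hW
  by_contra! h
  let S : Finset W := Finset.univ.erase 0
  have hS : S.card = Fintype.card E - 1 := by
    rw [Finset.card_erase_of_mem (Finset.mem_univ _), Finset.card_univ, hW]
  have hP0 {w : W} (hw : w ≠ 0) : P w ≠ 0 := (map_ne_zero_iff P hP).2 hw
  have himage : 2 * (S.image fun w ↦ Q w / P w).card ≤ S.card := by
    refine Finset.mul_card_image_le_card S 2 fun b hb ↦ ?_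
    obtain ⟨w, hw, rfl⟩ := Finset.mem_image.1 hb
    have hw0 : w ≠ 0 := Finset.ne_of_mem_erase hw
    refine Finset.one_lt_card.2 ⟨w, by simp [hw], a • w, ?_, fun hEq ↦ ha' ?_⟩
    · have : algebraMap F E a ≠ 0 := by simpa using ha
      simp [S, ha, hw0, Algebra.smul_def, mul_div_mul_left _ _ this]
    · exact smul_left_injective F hw0 (by simpa using hEq.symm)
  have hcover : (Finset.univ : Finset E) ⊆ {0, 1} ∪ S.image fun w ↦ Q w / P w := by
    intro c _
    by_cases h0 : c = 0
    · simp [h0]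
    by_cases h1 : c = 1
    · simp [h1]
    obtain ⟨w, hw, hw0⟩ := h c h0 h1
    refine Finset.mem_union_right _ (Finset.mem_image.2 ⟨w, by simp [S, hw0], ?_⟩)
    rw [hw, mul_div_cancel_right₀ _ (hP0 hw0)]
  have h1 := (Finset.card_le_card hcover).trans (Finset.card_union_le _ _)
  have h2 : ({0, 1} : Finset E).card ≤ 2 := Finset.card_le_two
  rw [Finset.card_univ] at h1
  omega

/-- A finite field has an extension of every positive degree. -/
theorem exists_field_extension_finrank_eq (F : Type*) [Field F] [Finite F] {k : ℕ} (hk : k ≠ 0) :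
    ∃ (E : Type) (_ : Field E) (_ : Algebra F E), Finite E ∧ finrank F E = k := by
  obtain ⟨p, hp⟩ := CharP.exists F
  have : Fact p.Prime := ⟨CharP.char_is_prime F p⟩
  have : NeZero k := ⟨hk⟩
  exact ⟨FiniteField.Extension F p k, inferInstance, inferInstance, inferInstance,
    FiniteField.finrank_extension F p k⟩

section PartialSpread

variable {F V : Type*} [Field F] [AddCommGroup V] [Module F V] {A B C D : Submodule F V}

/-- In characteristic two, four pairwise disjoint subspaces, the middle two of which are complements
of `B`, admit a further subspace disjoint from all of them. -/
theorem exists_disjoint_of_two_eq_zero (h2 : (2 : F) = 0) (hAB : IsCompl A B) (hCB : IsCompl C B)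
    (hAC : Disjoint A C) (hAD : Disjoint A D) (hBD : Disjoint B D) (hCD : Disjoint C D) :
    ∃ σ : Submodule F V, finrank F σ = finrank F D ∧
      Disjoint σ A ∧ Disjoint σ B ∧ Disjoint σ C ∧ Disjoint σ D := by
  have add_self (v : V) : v + v = 0 := by rw [← two_smul F v, h2, zero_smul]
  have neg_eq (v : V) : -v = v := neg_eq_of_add_eq_zero_left (add_self v)
  let p := A.projection B hAB
  let r := C.projection B hCB
  let L : V →ₗ[F] V := LinearMap.id + p + r
  have hpA (v : V) : p v ∈ A := Submodule.projection_apply_mem hAB v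
  have hrC (v : V) : r v ∈ C := Submodule.projection_apply_mem hCB v
  have hpB (v : V) : v + p v ∈ B := by
    have := Submodule.sub_projection_mem hAB v
    rwa [sub_eq_add_neg, neg_eq] at this
  have hrB (v : V) : v + r v ∈ B := by
    have := Submodule.sub_projection_mem hCB v
    rwa [sub_eq_add_neg, neg_eq] at this
  have eq_of_add {x y : V} (h : x + y = 0) : x = y := by
    rw [eq_neg_of_add_eq_zero_left h, neg_eq]
  have hLA {v : V} (hv : v ∈ D) (h : L v ∈ A) : v = 0 := by
    have h1 : v + r v ∈ A := by
      convert! A.sub_mem h (hpA v) using 1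
      simp only [L, LinearMap.add_apply, LinearMap.id_apply]
      abel
    have h3 := eq_of_add (Submodule.disjoint_def.1 hAB.disjoint _ h1 (hrB v))
    exact Submodule.disjoint_def.1 hCD _ (h3 ▸ hrC v) hv
  have hLB {v : V} (hv : v ∈ D) (h : L v ∈ B) : v = 0 := by
    have h1 : p v ∈ B := by
      convert! B.sub_mem h (hrB v) using 1
      simp only [L, LinearMap.add_apply, LinearMap.id_apply]
      abel
    have h3 : p v = 0 := Submodule.disjoint_def.1 hAB.disjoint _ (hpA v) h1
    have h4 := hpB v
    rw [h3, add_zero] at h4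
    exact Submodule.disjoint_def.1 hBD _ h4 hv
  have hLC {v : V} (hv : v ∈ D) (h : L v ∈ C) : v = 0 := by
    have h1 : v + p v ∈ C := by
      convert! C.sub_mem h (hrC v) using 1
      simp only [L, LinearMap.add_apply, LinearMap.id_apply]
      abel
    have h3 := eq_of_add (Submodule.disjoint_def.1 hCB.disjoint _ h1 (hpB v))
    exact Submodule.disjoint_def.1 hAD _ (h3 ▸ hpA v) hv
  have hLD {v : V} (hv : v ∈ D) (h : L v ∈ D) : v = 0 := by
    have h1 : p v + r v ∈ D := by
      convert! D.sub_mem h hv using 1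
      simp only [L, LinearMap.add_apply, LinearMap.id_apply]
      abel
    have h3 : p v + r v ∈ B := by
      convert! B.add_mem (hpB v) (hrB v) using 1
      rw [add_add_add_comm, add_self, zero_add]
    have h4 := eq_of_add (Submodule.disjoint_def.1 hBD _ h3 h1)
    have h5 : p v = 0 := Submodule.disjoint_def.1 hAC _ (hpA v) (h4 ▸ hrC v)
    have h6 := hpB v
    rw [h5, add_zero] at h6
    exact Submodule.disjoint_def.1 hBD _ h6 hv
  have disj {U : Submodule F V} (hU : ∀ {v : V}, v ∈ D → L v ∈ U → v = 0) :
      Disjoint (D.map L) U := by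
    rw [Submodule.disjoint_def]
    rintro _ ⟨v, hv, rfl⟩ h
    rw [hU hv h, map_zero]
  refine ⟨D.map L, ?_, disj hLA, disj hLB, disj hLC, disj hLD⟩
  have hinj : Function.Injective (L.domRestrict D) := by
    rw [← LinearMap.ker_eq_bot, LinearMap.ker_eq_bot']
    rintro ⟨v, hv⟩ h
    exact Subtype.ext (hLA hv ((show L v = 0 from h) ▸ A.zero_mem))
  rw [← LinearMap.range_domRestrict, LinearMap.finrank_range_of_inj hinj]

/-- If the scalars have an element other than `0` and `1`, four pairwise disjoint subspaces of half
dimension admit a fifth one, taken from the Desarguesian spread through three of them. -/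
theorem exists_disjoint_of_ne_zero_of_ne_one [Finite F] [FiniteDimensional F V] {a : F}
    (ha : a ≠ 0) (ha' : a ≠ 1) {k : ℕ} (hk : k ≠ 0) (hqk : 4 ≤ Nat.card F ^ k)
    (hV : finrank F V = 2 * k) (hA : finrank F A = k) (hC : finrank F C = k)
    (hD : finrank F D = k) (hAB : Disjoint A B) (hCB : IsCompl C B) (hCA : IsCompl C A)
    (hBD : Disjoint B D) :
    ∃ σ : Submodule F V, finrank F σ = k ∧
      Disjoint σ A ∧ Disjoint σ B ∧ Disjoint σ C ∧ Disjoint σ D := by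
  obtain ⟨E, _, _, _, hEk⟩ := exists_field_extension_finrank_eq F hk
  have : Module.Finite F E := Module.Finite.of_finite
  have hcardE : Nat.card E = Nat.card F ^ k := by rw [Module.natCard_eq_pow_finrank (K := F), hEk]
  let e : C ≃ₗ[F] E := LinearEquiv.ofFinrankEq C E (by rw [hC, hEk])
  let P : V →ₗ[F] E := e.toLinearMap ∘ₗ C.projectionOnto B hCB
  let Q : V →ₗ[F] E := e.toLinearMap ∘ₗ C.projectionOnto A hCA
  have hP {v : V} : P v = 0 ↔ v ∈ B := by simp [P]
  have hQ {v : V} : Q v = 0 ↔ v ∈ A := by simp [Q]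
  have hPQ {v : V} (hv : v ∈ C) : Q v = P v := by
    simp [P, Q, Submodule.projectionOnto_apply_of_mem_left _ hv]
  obtain ⟨c, hc0, hc1, hc⟩ := exists_ne_mul_of_injective (hcardE ▸ hqk)
    (P := P.domRestrict D) (Q := Q.domRestrict D)
    (by
      rw [← LinearMap.ker_eq_bot, LinearMap.ker_eq_bot']
      rintro ⟨v, hv⟩ h
      exact Subtype.ext (Submodule.disjoint_def.1 hBD _ (hP.1 h) hv))
    (by rw [Module.natCard_eq_pow_finrank (K := F), hD, hcardE]) ha ha'
  let T : V →ₗ[F] E := Q - LinearMap.mulLeft F c ∘ₗ P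
  have hT {v : V} : v ∈ LinearMap.ker T ↔ Q v = c * P v := by simp [T, sub_eq_zero]
  have hTB : Disjoint (LinearMap.ker T) B := by
    rw [Submodule.disjoint_def]
    intro v hv hvB
    rw [hT, hP.2 hvB, mul_zero] at hv
    exact Submodule.disjoint_def.1 hAB _ (hQ.1 hv) hvB
  have hTA : Disjoint (LinearMap.ker T) A := by
    rw [Submodule.disjoint_def]
    intro v hv hvA
    rw [hT, hQ.2 hvA, eq_comm, mul_eq_zero_iff_left hc0] at hv
    exact Submodule.disjoint_def.1 hAB _ hvA (hP.1 hv)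
  have hTC : Disjoint (LinearMap.ker T) C := by
    rw [Submodule.disjoint_def]
    intro v hv hvC
    rw [hT, hPQ hvC] at hv
    have h0 : P v = 0 := by
      by_contra h
      exact hc1 (mul_right_cancel₀ h (by rw [← hv, one_mul]))
    exact Submodule.disjoint_def.1 hCB.disjoint _ hvC (hP.1 h0)
  have hTD : Disjoint (LinearMap.ker T) D := by
    rw [Submodule.disjoint_def]
    intro v hv hvD
    simpa using hc ⟨v, hvD⟩ (hT.1 hv)
  refine ⟨LinearMap.ker T, ?_, hTA, hTB, hTC, hTD⟩
  have h1 := T.finrank_range_add_finrank_ker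
  have h2 := Submodule.finrank_le (LinearMap.range T)
  have h3 := Submodule.finrank_add_finrank_le_of_disjoint hTA
  omega

end PartialSpread

theorem partial_spread_four_extends
    (F V : Type*) [Field F] [Fintype F] [AddCommGroup V] [Module F V]
    [FiniteDimensional F V] (q k : ℕ)
    (hq : Fintype.card F = q) (hk : 1 ≤ k) (hqk : 4 ≤ q ^ k)
    (hV : finrank F V = 2 * k)
    (π : Fin 4 → Submodule F V) (hdim : ∀ i, finrank F (π i) = k)
    (hdisj : ∀ i j, i ≠ j → π i ⊓ π j = ⊥) :
    ∃ σ : Submodule F V, finrank F σ = k ∧ ∀ i, σ ⊓ π i = ⊥ := by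
  have hd {i j : Fin 4} (hij : i ≠ j) : Disjoint (π i) (π j) := disjoint_iff.2 (hdisj i j hij)
  have hc {i j : Fin 4} (hij : i ≠ j) : IsCompl (π i) (π j) :=
    (Submodule.isCompl_iff_disjoint _ _ (by rw [hV, hdim, hdim, two_mul])).2 (hd hij)
  have key : ∃ σ : Submodule F V, finrank F σ = k ∧
      Disjoint σ (π 0) ∧ Disjoint σ (π 1) ∧ Disjoint σ (π 2) ∧ Disjoint σ (π 3) := by
    by_cases ha : ∃ a : F, a ≠ 0 ∧ a ≠ 1
    · obtain ⟨a, ha, ha'⟩ := ha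
      exact exists_disjoint_of_ne_zero_of_ne_one ha ha' (by omega)
        (by rwa [Nat.card_eq_fintype_card, hq]) hV (hdim 0) (hdim 2) (hdim 3)
        (hd (by decide)) (hc (by decide)) (hc (by decide)) (hd (by decide))
    · push Not at ha
      have h2 : (2 : F) = 0 := by
        by_contra h
        have h1 : (1 : F) + 1 = 1 := by rw [one_add_one_eq_two, ha 2 h]
        simp at h1
      rw [← hdim 3]
      exact exists_disjoint_of_two_eq_zero h2 (hc (by decide)) (hc (by decide))
        (hd (by decide)) (hd (by decide)) (hd (by decide)) (hd (by decide))
  obtain ⟨σ, hσ, h0, h1, h2, h3⟩ := key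
  refine ⟨σ, hσ, fun i ↦ disjoint_iff.1 ?_⟩
  fin_cases i
  exacts [h0, h1, h2, h3]
end
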